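/- arXiv:1903.11650 — 3 statements merged into one kernel-verified Lean document; each statement's English description precedes it below -/
import Mathlib

section
/- Let N ≥ 1, h_1, …, h_N > 0, σ² > 0, α > 0, and target rates R̄_1, …, R̄_N ≥ 0. Define p*_N, p*_{N−1}, …, p*_1 by the backward recursion p*_i = (Σ_{l=i+1}^{N} p*_l + σ²/(α·h_i²))·(2^{R̄_i} − 1). Then the total power satisfies the closed-form identity Σ_{i=1}^{N} p*_i = (σ²/α)·Σ_{l=1}^{N} (Π_{m=1}^{l−1} 2^{R̄_m})·(2^{R̄_l} − 1)/h_l². -/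
open Finset

/-- Unrolling the first `k` steps of the backward affine recursion
`p i = (∑ l ∈ Icc (i + 1) N, p l + c i) * (a i - 1)` for the total `∑ p i`. -/
theorem sum_Icc_eq_of_backward_recursion {N : ℕ} {a c p : ℕ → ℝ}
    (hrec : ∀ i ∈ Icc 1 N, p i = ((∑ l ∈ Icc (i + 1) N, p l) + c i) * (a i - 1))
    {k : ℕ} (hk : k ≤ N) :
    ∑ i ∈ Icc 1 N, p i =
      (∑ l ∈ Icc 1 k, (∏ m ∈ Icc 1 (l - 1), a m) * (a l - 1) * c l) +
        (∏ m ∈ Icc 1 k, a m) * ∑ l ∈ Icc (k + 1) N, p l := by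
  induction k with
  | zero => simp
  | succ k ih =>
    have hsplit : ∑ l ∈ Icc (k + 1) N, p l = p (k + 1) + ∑ l ∈ Icc (k + 1 + 1) N, p l := by
      rw [← insert_Icc_add_one_left_eq_Icc hk, sum_insert (by simp)]
    rw [ih (by omega), hsplit, hrec (k + 1) (mem_Icc.2 ⟨by omega, hk⟩),
      sum_Icc_succ_top (by omega), prod_Icc_succ_top (by omega), Nat.add_sub_cancel]
    ring

/-- the backward recursion
`p*ᵢ = (Σ_{l=i+1}^{N} p*_l + σ²/(α·hᵢ²))·(2^{R̄ᵢ} − 1)`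
yields the closed-form total power
`Σᵢ p*ᵢ = (σ²/α)·Σ_l (Π_{m<l} 2^{R̄ₘ})·(2^{R̄_l} − 1)/h_l²`. -/
theorem total_power_closed_form
    (N : ℕ) (hN : 1 ≤ N) (h Rbar pstar : ℕ → ℝ) (σ2 α : ℝ)
    (hσ : 0 < σ2) (hα : 0 < α)
    (hh : ∀ i ∈ Finset.Icc 1 N, 0 < h i)
    (hR : ∀ i ∈ Finset.Icc 1 N, 0 ≤ Rbar i)
    (hrec : ∀ i ∈ Finset.Icc 1 N,
      pstar i = ((∑ l ∈ Finset.Icc (i + 1) N, pstar l) + σ2 / (α * (h i) ^ 2)) *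
        ((2 : ℝ) ^ (Rbar i) - 1)) :
    ∑ i ∈ Finset.Icc 1 N, pstar i =
      (σ2 / α) * ∑ l ∈ Finset.Icc 1 N,
        (∏ m ∈ Finset.Icc 1 (l - 1), (2 : ℝ) ^ (Rbar m)) *
          ((2 : ℝ) ^ (Rbar l) - 1) / (h l) ^ 2 := by
  rw [sum_Icc_eq_of_backward_recursion hrec le_rfl, Icc_eq_empty_of_lt N.lt_succ_self, sum_empty,
    mul_zero, add_zero, mul_sum]
  refine sum_congr rfl fun l _ => ?_
  ring
end

section
/- Let N ≥ 1, h_1, …, h_N > 0, σ² > 0, α > 0, and R̄_1, …, R̄_N ≥ 0. If p_1, …, p_N ≥ 0 satisfy all rate constraints R_i(p) = log₂((h_i²·a_i(p) + σ²/α)/(h_i²·a_{i+1}(p) + σ²/α)) ≥ R̄_i for i = 1, …, N, then the total power is at least the closed-form minimum: Σ_{i=1}^{N} p_i ≥ (σ²/α)·Σ_{l=1}^{N} (Π_{m=1}^{l−1} 2^{R̄_m})·(2^{R̄_l} − 1)/h_l². Consequently, the minimum of ‖p‖₁ over all p ≥ 0 satisfying the rate constraints equals this closed form. -/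
open Finset

/-- Cumulative power `a_i = Σ_{l=i}^{N} p_l` (so `a_{N+1} = 0`). -/
noncomputable def cumPow (N : ℕ) (p : ℕ → ℝ) (i : ℕ) : ℝ := ∑ l ∈ Finset.Icc i N, p l

/-- Per-user SIC rate `R_i(p) = log₂((hᵢ²·aᵢ(p) + c)/(hᵢ²·a_{i+1}(p) + c))`, `c = σ²/α`. -/
noncomputable def rate (N : ℕ) (h : ℕ → ℝ) (c : ℝ) (p : ℕ → ℝ) (i : ℕ) : ℝ :=
  Real.logb 2 (((h i) ^ 2 * cumPow N p i + c) / ((h i) ^ 2 * cumPow N p (i + 1) + c))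

/-- The least cumulative power of users `i, …, N` meeting their minimum rates, in closed form. -/
noncomputable def minCumPow (N : ℕ) (h R : ℕ → ℝ) (c : ℝ) (i : ℕ) : ℝ :=
  c * ∑ l ∈ Finset.Icc i N,
    (∏ m ∈ Finset.Icc i (l - 1), (2 : ℝ) ^ (R m)) * ((2 : ℝ) ^ (R l) - 1) / (h l) ^ 2

@[to_additive]
theorem prod_Icc_eq_mul_prod_Icc_succ {M : Type*} [CommMonoid M] {i N : ℕ} (hi : i ≤ N)
    (f : ℕ → M) : ∏ l ∈ Finset.Icc i N, f l = f i * ∏ l ∈ Finset.Icc (i + 1) N, f l := by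
  have hIoc : Finset.Icc (i + 1) N = Finset.Ioc i N := by
    ext
    simp only [Finset.mem_Icc, Finset.mem_Ioc, Nat.succ_le_iff]
  rw [hIoc, Finset.mul_prod_Ioc_eq_prod_Icc hi]

theorem cumPow_eq_add {i N : ℕ} (hi : i ≤ N) (p : ℕ → ℝ) :
    cumPow N p i = p i + cumPow N p (i + 1) :=
  sum_Icc_eq_add_sum_Icc_succ hi p

theorem cumPow_nonneg {i N : ℕ} (hi : 1 ≤ i) {p : ℕ → ℝ} (hp : ∀ l ∈ Finset.Icc 1 N, 0 ≤ p l) :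
    0 ≤ cumPow N p i :=
  Finset.sum_nonneg fun l hl => hp l (Finset.Icc_subset_Icc_left hi hl)

theorem cumPow_succ_self (N : ℕ) (p : ℕ → ℝ) : cumPow N p (N + 1) = 0 := by
  simp [cumPow]

theorem minCumPow_succ_self (N : ℕ) (h R : ℕ → ℝ) (c : ℝ) : minCumPow N h R c (N + 1) = 0 := by
  simp [minCumPow]

theorem minCumPow_eq {i N : ℕ} (hi : 1 ≤ i) (hiN : i ≤ N) (h R : ℕ → ℝ) (c : ℝ) :
    minCumPow N h R c i =
      (2 : ℝ) ^ (R i) * minCumPow N h R c (i + 1) + c * ((2 : ℝ) ^ (R i) - 1) / (h i) ^ 2 := by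
  have hempty : Finset.Icc i (i - 1) = ∅ := Finset.Icc_eq_empty (by omega)
  have hsum : ∑ l ∈ Finset.Icc (i + 1) N,
        (∏ m ∈ Finset.Icc i (l - 1), (2 : ℝ) ^ (R m)) * ((2 : ℝ) ^ (R l) - 1) / (h l) ^ 2 =
      (2 : ℝ) ^ (R i) * ∑ l ∈ Finset.Icc (i + 1) N,
        (∏ m ∈ Finset.Icc (i + 1) (l - 1), (2 : ℝ) ^ (R m)) * ((2 : ℝ) ^ (R l) - 1) /
          (h l) ^ 2 := by
    rw [Finset.mul_sum]
    refine Finset.sum_congr rfl fun l hl => ?_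
    rw [Finset.mem_Icc] at hl
    rw [prod_Icc_eq_mul_prod_Icc_succ (show i ≤ l - 1 by omega)]
    ring
  rw [minCumPow, minCumPow, sum_Icc_eq_add_sum_Icc_succ hiN, hsum, hempty, Finset.prod_empty]
  ring

theorem minCumPow_nonneg {i N : ℕ} (hi : 1 ≤ i) {h R : ℕ → ℝ} {c : ℝ} (hc : 0 ≤ c)
    (hR : ∀ l ∈ Finset.Icc 1 N, 0 ≤ R l) : 0 ≤ minCumPow N h R c i := by
  refine mul_nonneg hc (Finset.sum_nonneg fun l hl => ?_)
  have hl' : 1 ≤ (2 : ℝ) ^ (R l) :=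
    Real.one_le_rpow one_le_two (hR l (Finset.Icc_subset_Icc_left hi hl))
  have := sub_nonneg.2 hl'
  positivity

/-- A rate constraint is an affine lower bound on the cumulative power. -/
theorem le_rate_iff {i N : ℕ} {h p : ℕ → ℝ} {c r : ℝ} (hc : 0 < c) (hi : 0 < h i)
    (ha : 0 ≤ cumPow N p i) (ha' : 0 ≤ cumPow N p (i + 1)) :
    r ≤ rate N h c p i ↔
      (2 : ℝ) ^ r * cumPow N p (i + 1) + c * ((2 : ℝ) ^ r - 1) / (h i) ^ 2 ≤ cumPow N p i := by
  have hden : 0 < (h i) ^ 2 * cumPow N p (i + 1) + c := by positivity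
  have hnum : 0 < (h i) ^ 2 * cumPow N p i + c := by positivity
  rw [rate, Real.le_logb_iff_rpow_le one_lt_two (div_pos hnum hden), le_div_iff₀ hden,
    ← le_sub_iff_add_le', div_le_iff₀ (by positivity : 0 < (h i) ^ 2)]
  constructor <;> intro H <;> linarith

theorem minCumPow_le_cumPow {N : ℕ} {h R p : ℕ → ℝ} {c : ℝ} (hc : 0 < c)
    (hh : ∀ i ∈ Finset.Icc 1 N, 0 < h i) (hp : ∀ i ∈ Finset.Icc 1 N, 0 ≤ p i)
    (hrate : ∀ i ∈ Finset.Icc 1 N, R i ≤ rate N h c p i) {i : ℕ} (hi : 1 ≤ i) (hiN : i ≤ N + 1) :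
    minCumPow N h R c i ≤ cumPow N p i := by
  induction hiN using Nat.decreasingInduction with
  | self => rw [cumPow_succ_self, minCumPow_succ_self]
  | of_succ k hk ih =>
    have hkN : k ≤ N := by omega
    have hmem : k ∈ Finset.Icc 1 N := Finset.mem_Icc.2 ⟨hi, hkN⟩
    have hbound := (le_rate_iff hc (hh k hmem) (cumPow_nonneg hi hp)
      (cumPow_nonneg (by omega) hp)).1 (hrate k hmem)
    rw [minCumPow_eq hi hkN]
    refine le_trans ?_ hbound
    gcongr
    exact ih (by omega)

theorem cumPow_minCumPow_sub (N : ℕ) (h R : ℕ → ℝ) (c : ℝ) {i : ℕ} (hiN : i ≤ N + 1) :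
    cumPow N (fun l => minCumPow N h R c l - minCumPow N h R c (l + 1)) i =
      minCumPow N h R c i := by
  induction hiN using Nat.decreasingInduction with
  | self => rw [cumPow_succ_self, minCumPow_succ_self]
  | of_succ k hk ih => rw [cumPow_eq_add (by omega), ih, sub_add_cancel]

/-- any nonnegative power vector meeting all minimum rate constraints uses at
least the closed-form total power `(σ²/α)·Σ_l (Π_{m<l} 2^{R̄ₘ})·(2^{R̄_l} − 1)/h_l²`;
consequently the minimum of `‖p‖₁` over the feasible set equals this closed form. -/
theorem min_total_power_closed_form
    (N : ℕ) (hN : 1 ≤ N) (h Rbar p : ℕ → ℝ) (σ2 α : ℝ)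
    (hσ : 0 < σ2) (hα : 0 < α)
    (hh : ∀ i ∈ Finset.Icc 1 N, 0 < h i)
    (hR : ∀ i ∈ Finset.Icc 1 N, 0 ≤ Rbar i)
    (hp : ∀ i ∈ Finset.Icc 1 N, 0 ≤ p i)
    (hrate : ∀ i ∈ Finset.Icc 1 N, rate N h (σ2 / α) p i ≥ Rbar i) :
    (∑ i ∈ Finset.Icc 1 N, p i ≥
      (σ2 / α) * ∑ l ∈ Finset.Icc 1 N,
        (∏ m ∈ Finset.Icc 1 (l - 1), (2 : ℝ) ^ (Rbar m)) *
          ((2 : ℝ) ^ (Rbar l) - 1) / (h l) ^ 2) ∧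
    IsLeast {s : ℝ | ∃ q : ℕ → ℝ, (∀ i ∈ Finset.Icc 1 N, 0 ≤ q i) ∧
        (∀ i ∈ Finset.Icc 1 N, rate N h (σ2 / α) q i ≥ Rbar i) ∧
        s = ∑ i ∈ Finset.Icc 1 N, q i}
      ((σ2 / α) * ∑ l ∈ Finset.Icc 1 N,
        (∏ m ∈ Finset.Icc 1 (l - 1), (2 : ℝ) ^ (Rbar m)) *
          ((2 : ℝ) ^ (Rbar l) - 1) / (h l) ^ 2) := by
  have hc : 0 < σ2 / α := div_pos hσ hα
  refine ⟨minCumPow_le_cumPow hc hh hp hrate le_rfl (by omega),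
    ⟨fun l => minCumPow N h Rbar (σ2 / α) l - minCumPow N h Rbar (σ2 / α) (l + 1),
      fun i hi => ?_, fun i hi => ?_, (cumPow_minCumPow_sub N h Rbar _ (by omega)).symm⟩, ?_⟩
  · obtain ⟨h1, h2⟩ := Finset.mem_Icc.1 hi
    have hnext : 0 ≤ minCumPow N h Rbar (σ2 / α) (i + 1) :=
      minCumPow_nonneg (by omega) hc.le hR
    have ht : 0 ≤ (2 : ℝ) ^ (Rbar i) - 1 :=
      sub_nonneg.2 (Real.one_le_rpow one_le_two (hR i hi))
    have hterm : 0 ≤ (σ2 / α) * ((2 : ℝ) ^ (Rbar i) - 1) / (h i) ^ 2 := by positivity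
    beta_reduce
    rw [minCumPow_eq h1 h2]
    linarith [mul_nonneg ht hnext]
  · obtain ⟨h1, h2⟩ := Finset.mem_Icc.1 hi
    have hcum := cumPow_minCumPow_sub N h Rbar (σ2 / α) (show i ≤ N + 1 by omega)
    have hcum' := cumPow_minCumPow_sub N h Rbar (σ2 / α) (show i + 1 ≤ N + 1 by omega)
    refine (le_rate_iff hc (hh i hi) ?_ ?_).2 ?_
    · exact hcum ▸ minCumPow_nonneg h1 hc.le hR
    · exact hcum' ▸ minCumPow_nonneg (by omega) hc.le hR
    · rw [hcum, hcum', ← minCumPow_eq h1 h2]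
  · rintro s ⟨q, hq, hqrate, rfl⟩
    exact minCumPow_le_cumPow hc hh hq hqrate le_rfl (by omega)
end

section
/- Let N ≥ 1, c > 0, and channel gains sorted as 0 < h_1 ≤ h_2 ≤ … ≤ h_N. The per-beam sum-rate objective f(p) = Σ_{i=1}^{N} log₂((h_i²·a_i(p) + c)/(h_i²·a_{i+1}(p) + c)), where a_i(p) = Σ_{l=i}^{N} p_l and a_{N+1}(p) = 0, is a concave function of p on the nonnegative orthant {p ∈ ℝ^N : p_i ≥ 0 for all i}. -/
open Finset

/-- If `0 ≤ v ≤ u`, the ratio `(u x + c) / (v x + c)` is concave in `x ≥ 0`. -/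
lemma concaveOn_affine_div_affine {u v c : ℝ} (hc : 0 < c) (hv : 0 ≤ v) (huv : v ≤ u) :
    ConcaveOn ℝ (Set.Ici 0) fun x : ℝ => (u * x + c) / (v * x + c) := by
  refine ⟨convex_Ici 0, fun x hx y hy s t hs ht hst => ?_⟩
  simp only [Set.mem_Ici, smul_eq_mul] at *
  have hX : 0 < v * x + c := by positivity
  have hY : 0 < v * y + c := by positivity
  have hZ : 0 < v * (s * x + t * y) + c := by positivity
  obtain rfl : t = 1 - s := by linarith
  rw [← sub_nonneg]
  have key : (u * (s * x + (1 - s) * y) + c) / (v * (s * x + (1 - s) * y) + c)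
      - (s * ((u * x + c) / (v * x + c)) + (1 - s) * ((u * y + c) / (v * y + c)))
      = c * (u - v) * v * (s * (1 - s)) * (x - y) ^ 2
        / ((v * (s * x + (1 - s) * y) + c) * (v * x + c) * (v * y + c)) := by
    field_simp
    ring
  rw [key]
  have := sub_nonneg.2 huv
  positivity

/-- If `0 ≤ v ≤ u`, then `log₂ (u x + c) - log₂ (v x + c)` is concave in `x ≥ 0`. -/
lemma concaveOn_logb_affine_sub_logb_affine {u v c : ℝ} (hc : 0 < c) (hv : 0 ≤ v)
    (huv : v ≤ u) :
    ConcaveOn ℝ (Set.Ici 0) fun x : ℝ =>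
      Real.logb 2 (u * x + c) - Real.logb 2 (v * x + c) := by
  refine ⟨convex_Ici 0, fun x hx y hy s t hs ht hst => ?_⟩
  have hu : 0 ≤ u := hv.trans huv
  have hpos : ∀ {w z : ℝ}, 0 ≤ w → z ∈ Set.Ici (0 : ℝ) → 0 < w * z + c := fun hw hz =>
    add_pos_of_nonneg_of_pos (mul_nonneg hw hz) hc
  have hz := convex_Ici (0 : ℝ) hx hy hs ht hst
  have hratio {z : ℝ} (hz : z ∈ Set.Ici (0 : ℝ)) : 0 < (u * z + c) / (v * z + c) :=
    div_pos (hpos hu hz) (hpos hv hz)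
  have hlogb {z : ℝ} (hz : z ∈ Set.Ici (0 : ℝ)) :
      Real.logb 2 (u * z + c) - Real.logb 2 (v * z + c)
        = Real.log ((u * z + c) / (v * z + c)) / Real.log 2 := by
    rw [← Real.logb_div (hpos hu hz).ne' (hpos hv hz).ne', Real.logb]
  have hlog := strictConcaveOn_log_Ioi.concaveOn.2 (hratio hx) (hratio hy) hs ht hst
  have hmono := Real.log_le_log
    (convex_Ioi (0 : ℝ) (hratio hx) (hratio hy) hs ht hst)
    ((concaveOn_affine_div_affine hc hv huv).2 hx hy hs ht hst)
  simp only [hlogb hx, hlogb hy, hlogb hz]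
  simp only [smul_eq_mul] at hlog hmono ⊢
  rw [← mul_div_assoc, ← mul_div_assoc, ← add_div]
  exact div_le_div_of_nonneg_right (hlog.trans hmono) (Real.log_nonneg one_le_two)

/-- Concavity of the rate of the users `k, …, N` after subtracting `log₂ (v a_k + c)`, for any
`v ≥ 0` below all of their squared gains. -/
lemma concaveOn_tail_sum_rate_sub_logb {N : ℕ} {c : ℝ} (hc : 0 < c) {g : ℕ → ℝ} (n : ℕ) :
    ∀ (k : ℕ), k + n = N + 1 → MonotoneOn g (Set.Icc k N) →
      ∀ v : ℝ, 0 ≤ v → (∀ i ∈ Set.Icc k N, v ≤ g i) →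
      ConcaveOn ℝ {p : ℕ → ℝ | ∀ i, 0 ≤ p i} fun p =>
        ∑ i ∈ Finset.Icc k N,
          Real.logb 2 ((g i * (∑ l ∈ Finset.Icc i N, p l) + c) /
            (g i * (∑ l ∈ Finset.Icc (i + 1) N, p l) + c))
        - Real.logb 2 (v * (∑ l ∈ Finset.Icc k N, p l) + c) := by
  have hconv : Convex ℝ {p : ℕ → ℝ | ∀ i, 0 ≤ p i} := convex_Ici (0 : ℕ → ℝ)
  induction n with
  | zero =>
    intro k hk _ v _ _
    have hempty : Finset.Icc k N = ∅ := Finset.Icc_eq_empty (by omega)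
    simpa [hempty] using concaveOn_const (-Real.logb 2 c) hconv
  | succ n ih =>
    intro k hk hg v hv hvg
    have hkN : k ≤ N := by omega
    have hsub : Set.Icc (k + 1) N ⊆ Set.Icc k N := Set.Icc_subset_Icc_left k.le_succ
    have hkmem : k ∈ Set.Icc k N := ⟨le_rfl, hkN⟩
    have hgk : 0 ≤ g k := hv.trans (hvg k hkmem)
    have htail := ih (k + 1) (by omega) (hg.mono hsub) (g k) hgk
      fun i hi => hg hkmem (hsub hi) (hsub hi).1
    have hhead := ((concaveOn_logb_affine_sub_logb_affine hc hv (hvg k hkmem)).comp_linearMap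
      (∑ l ∈ Finset.Icc k N, LinearMap.proj l : (ℕ → ℝ) →ₗ[ℝ] ℝ)).subset
      (fun p hp => by simpa using Finset.sum_nonneg fun l _ => hp l) hconv
    refine (hhead.add htail).congr fun p hp => ?_
    have hpos (j : ℕ) : 0 < g k * (∑ l ∈ Finset.Icc j N, p l) + c :=
      add_pos_of_nonneg_of_pos (mul_nonneg hgk (Finset.sum_nonneg fun l _ => hp l)) hc
    have hsplit : Finset.Icc k N = insert k (Finset.Icc (k + 1) N) :=
      (Finset.insert_Icc_add_one_left_eq_Icc hkN).symm
    have hsum (F : ℕ → ℝ) :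
        ∑ i ∈ Finset.Icc k N, F i = F k + ∑ i ∈ Finset.Icc (k + 1) N, F i := by
      rw [hsplit, Finset.sum_insert (by simp)]
    rw [hsum fun i => Real.logb 2 ((g i * (∑ l ∈ Finset.Icc i N, p l) + c) /
      (g i * (∑ l ∈ Finset.Icc (i + 1) N, p l) + c)),
      Real.logb_div (hpos k).ne' (hpos (k + 1)).ne']
    simp only [Pi.add_apply, Function.comp_apply, LinearMap.sum_apply, LinearMap.proj_apply]
    ring

/-- with channel gains sorted nondecreasingly and effective noise `c > 0`,
the per-beam sum rate
`f(p) = Σᵢ log₂((hᵢ²·aᵢ(p) + c)/(hᵢ²·a_{i+1}(p) + c))`, `aᵢ(p) = Σ_{l=i}^{N} p_l`,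
is concave on the nonnegative orthant. -/
theorem sum_rate_concave
    (N : ℕ) (hN : 1 ≤ N) (h : ℕ → ℝ) (c : ℝ) (hc : 0 < c)
    (hh : ∀ i ∈ Finset.Icc 1 N, 0 < h i)
    (hsort : ∀ i ∈ Finset.Icc 1 N, ∀ j ∈ Finset.Icc 1 N, i ≤ j → h i ≤ h j) :
    ConcaveOn ℝ {p : ℕ → ℝ | ∀ i, 0 ≤ p i}
      (fun p => ∑ i ∈ Finset.Icc 1 N,
        Real.logb 2 (((h i) ^ 2 * (∑ l ∈ Finset.Icc i N, p l) + c) /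
          ((h i) ^ 2 * (∑ l ∈ Finset.Icc (i + 1) N, p l) + c))) := by
  have hmono : MonotoneOn (fun i => h i ^ 2) (Set.Icc 1 N) := fun i hi j hj hij =>
    pow_le_pow_left₀ (hh i (Finset.mem_Icc.2 hi)).le
      (hsort i (Finset.mem_Icc.2 hi) j (Finset.mem_Icc.2 hj) hij) 2
  have hconcave := concaveOn_tail_sum_rate_sub_logb hc N 1 (add_comm 1 N) hmono 0 le_rfl
    fun i _ => sq_nonneg (h i)
  exact (hconcave.add_const (Real.logb 2 c)).congr fun p _ => by simp
end
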